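/- Fix integers k ≥ 2 and p ≥ 1, and let (w_{1,n}, …, w_{p,n}) be independent F_k-valued random variables satisfying radial symmetry, positive drift, and subexponential growth. Then with probability going to 1 exponentially fast as n → ∞: for every non-trivial element g of the subgroup H = ⟨w_{1,n}, …, w_{p,n}⟩, the cyclic reduction of g is strictly Whitehead minimal, i.e., every cyclic permutation g' of the cyclic reduction of g satisfies |φ(g')| > |g'| for every Whitehead automorphism φ = φ_{(A,a)} that is not an inner automorphism of F_k. -/

import Mathlib

open MeasureTheory

noncomputable section

open scoped Classical

/-- Every set of a free group is measurable (discrete σ-algebra). -/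
instance freeGroupMeasurableSpace {α : Type*} : MeasurableSpace (FreeGroup α) := ⊤

/-- The length `|g|` of the reduced word representing `g`. -/
def wlen {k : ℕ} (g : FreeGroup (Fin k)) : ℕ := (FreeGroup.toWord g).length

/-- The inverse of a letter of `X^{±1}` (letters are encoded as `Fin k × Bool`). -/
def invL {k : ℕ} (a : Fin k × Bool) : Fin k × Bool := (a.1, !a.2)

/-- `g` is cyclically reduced: the concatenation of its reduced word with itself is
reduced (equivalently, the last letter is not the inverse of the first). -/
def IsCyclicallyReduced {k : ℕ} (g : FreeGroup (Fin k)) : Prop :=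
  FreeGroup.reduce (FreeGroup.toWord g ++ FreeGroup.toWord g) =
    FreeGroup.toWord g ++ FreeGroup.toWord g

/-- The Whitehead automorphism `φ_{(A,a)}` (as an endomorphism of `F_k`), for a letter
`a ∈ X^{±1}` and a set of letters `A ⊆ X^{±1}` (with `a ∈ A`, `a⁻¹ ∉ A` imposed
separately): on a letter `x ∈ X^{±1}`, `φ(x) = x` if `x ∈ {a, a⁻¹}`, and otherwise
`φ(x) = a^{-δ} x a^{ε}` where `ε = 1` iff `x ∈ A` and `δ = 1` iff `x⁻¹ ∈ A`. -/
noncomputable def whiteheadAut (k : ℕ) (A : Set (Fin k × Bool)) (a : Fin k × Bool) :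
    FreeGroup (Fin k) →* FreeGroup (Fin k) :=
  FreeGroup.lift fun x : Fin k =>
    if ((x, true) : Fin k × Bool) = a ∨ ((x, true) : Fin k × Bool) = invL a then
      FreeGroup.of x
    else
      (if invL (x, true) ∈ A then (FreeGroup.mk [a])⁻¹ else 1) * FreeGroup.of x *
        (if ((x, true) : Fin k × Bool) ∈ A then FreeGroup.mk [a] else 1)

/-- A family of "failure probabilities" decays exponentially: the corresponding events
hold with probability going to 1 exponentially fast as `n → ∞`. -/
def ExpDecay (f : ℕ → ENNReal) : Prop :=
  ∃ C : ℝ, 0 < C ∧ ∃ κ : ℝ, 1 < κ ∧ ∀ n : ℕ, f n ≤ ENNReal.ofReal (C / κ ^ n)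

/-- The sum of `f` over the pairs of consecutive entries of a list. -/
def pairSum {β : Type*} (f : β → β → ℝ) : List β → ℝ
  | [] => 0
  | [_] => 0
  | x :: y :: l => f x y + pairSum f (y :: l)

section PairSum

variable {β : Type*} {f : β → β → ℝ} {K : ℝ}

lemma abs_pairSum_append_sub_le (hf : ∀ x y, |f x y| ≤ K) (hK : 0 ≤ K) (p q : List β) :
    |pairSum f (p ++ q) - pairSum f p - pairSum f q| ≤ K := by
  induction p with
  | nil => simpa [pairSum] using hK
  | cons x p ih =>
    cases p with
    | nil =>
      cases q with
      | nil => simpa [pairSum] using hK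
      | cons y q => simpa [pairSum] using hf x y
    | cons y p =>
      simp only [List.cons_append, pairSum] at ih ⊢
      convert ih using 2
      ring

lemma abs_pairSum_le (hf : ∀ x y, |f x y| ≤ K) (hK : 0 ≤ K) (l : List β) :
    |pairSum f l| ≤ K * l.length := by
  induction l with
  | nil => simp [pairSum]
  | cons x l ih =>
    cases l with
    | nil => simpa [pairSum] using hK
    | cons y l =>
      have h := abs_add_le (f x y) (pairSum f (y :: l))
      have h' := hf x y
      rw [List.length_cons]
      push_cast at ih ⊢
      simp only [pairSum]
      linarith

/-- Adding a coboundary to the weight changes the sum over pairs by a bounded amount. -/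
lemma pairSum_coboundary_le {b : β → ℝ} {B : ℝ} (hb : ∀ x, |b x| ≤ B) (hB : 0 ≤ B) (l : List β) :
    pairSum (fun x y => f x y + b y - b x) l ≤ pairSum f l + 2 * B := by
  have key : ∀ x l, pairSum (fun x y => f x y + b y - b x) (x :: l) ≤
      pairSum f (x :: l) + B - b x := by
    intro x l
    induction l generalizing x with
    | nil => simp only [pairSum]; linarith [le_abs_self (b x), hb x]
    | cons y l ih => simp only [pairSum]; linarith [ih y]
  cases l with
  | nil => simp only [pairSum]; linarith
  | cons x l => linarith [key x l, neg_abs_le (b x), hb x]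

lemma pairSum_sub_const (c : ℝ) (x : β) (l : List β) :
    pairSum (fun x y => f x y - c) (x :: l) = pairSum f (x :: l) - c * l.length := by
  induction l generalizing x with
  | nil => simp [pairSum]
  | cons y l ih => simp only [pairSum, ih, List.length_cons]; push_cast; ring

end PairSum

/-- The element of a group tuple attached to a signed index. -/
def signedVal {β G : Type*} [Group G] (w : β → G) (x : β × Bool) : G := cond x.2 (w x.1) (w x.1)⁻¹

lemma signedVal_not {β G : Type*} [Group G] (w : β → G) (x : β × Bool) :
    signedVal w (x.1, !x.2) = (signedVal w x)⁻¹ := by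
  obtain ⟨i, _ | _⟩ := x <;> simp [signedVal]

section Cancellation

variable {α : Type*}

lemma isReduced_of_isInfix {L L' : List (α × Bool)} (h : FreeGroup.IsReduced L) (hL : L' <:+: L) :
    FreeGroup.IsReduced L' := by
  obtain ⟨s, t, rfl⟩ := hL
  exact (List.isChain_append.1 (List.isChain_append.1 h).1).2.1

lemma exists_cancellation_of_isReduced (L₂ L₁ : List (α × Bool)) (h₁ : FreeGroup.IsReduced L₁)
    (h₂ : FreeGroup.IsReduced L₂) :
    ∃ p q s, L₁ = p ++ q ∧ L₂ = FreeGroup.invRev q ++ s ∧ FreeGroup.IsReduced (p ++ s) := by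
  induction L₂ generalizing L₁ with
  | nil => exact ⟨L₁, [], [], by simp, by simp, by simpa using h₁⟩
  | cons x L₂ ih =>
    by_cases hx : ∃ L, L₁ = L ++ [(x.1, !x.2)]
    · obtain ⟨L, rfl⟩ := hx
      obtain ⟨p, q, s, rfl, rfl, h⟩ :=
        ih L (isReduced_of_isInfix h₁ ⟨[], [(x.1, !x.2)], by simp⟩)
          (isReduced_of_isInfix h₂ ⟨[x], [], by simp⟩)
      exact ⟨p, q ++ [(x.1, !x.2)], s, by rw [List.append_assoc], by simp [FreeGroup.invRev], h⟩
    · refine ⟨L₁, [], x :: L₂, by simp, by simp, ?_⟩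
      rw [FreeGroup.IsReduced, List.isChain_append]
      refine ⟨h₁, h₂, fun a ha b hb => ?_⟩
      simp only [List.head?_cons, Option.mem_def, Option.some.injEq] at hb
      subst hb
      intro hab
      by_contra hne
      obtain ⟨L, rfl⟩ := List.getLast?_eq_some_iff.1 ha
      refine hx ⟨L, ?_⟩
      congr 2
      exact Prod.ext hab (Bool.eq_not.2 hne)

variable [DecidableEq α]

lemma exists_toWord_mul (g h : FreeGroup α) : ∃ p q s, g.toWord = p ++ q ∧
    h.toWord = FreeGroup.invRev q ++ s ∧ (g * h).toWord = p ++ s := by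
  obtain ⟨p, q, s, h₁, h₂, h₃⟩ := exists_cancellation_of_isReduced h.toWord g.toWord
    FreeGroup.isReduced_toWord FreeGroup.isReduced_toWord
  refine ⟨p, q, s, h₁, h₂, ?_⟩
  rw [← h₃.reduce_eq, ← FreeGroup.toWord_mk]
  congr 1
  rw [← FreeGroup.mk_toWord (x := g), ← FreeGroup.mk_toWord (x := h), h₁, h₂]
  simp only [← FreeGroup.mul_mk, ← FreeGroup.inv_mk]
  group

/-- If the prefixes of length `t` of the words `w_i^{±1}` are distinct and each of these words
has a large pair sum, then the pair sum is nonnegative on the subgroup they generate. -/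
theorem pairSum_lift_nonneg {β : Type*} [DecidableEq β] {f : α × Bool → α × Bool → ℝ} {K : ℝ}
    (hf : ∀ x y, |f x y| ≤ K) (hK : 0 ≤ K) (w : β → FreeGroup α) (t : ℕ)
    (hlen : ∀ x, 2 * t ≤ (signedVal w x).toWord.length)
    (hdist : ∀ x y, (signedVal w x).toWord.take t = (signedVal w y).toWord.take t → x = y)
    (hsum : ∀ x, K * (2 * t + 3) ≤ pairSum f (signedVal w x).toWord) (y : FreeGroup β) :
    0 ≤ pairSum f (FreeGroup.lift w y).toWord := by
  have hmk : ∀ x L, FreeGroup.lift w (FreeGroup.mk (x :: L)) =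
      signedVal w x * FreeGroup.lift w (FreeGroup.mk L) := by
    intro x L
    simp [signedVal, FreeGroup.lift_mk]
  have key : ∀ L : List (β × Bool), FreeGroup.IsReduced L →
      0 ≤ pairSum f (FreeGroup.lift w (FreeGroup.mk L)).toWord ∧
      ∀ x ∈ L.head?, (FreeGroup.lift w (FreeGroup.mk L)).toWord.take t =
        (signedVal w x).toWord.take t := by
    intro L
    induction L with
    | nil => simp [← FreeGroup.one_eq_mk, pairSum]
    | cons x L ih =>
      intro hL
      cases L with
      | nil =>
        have h1 : FreeGroup.lift w (FreeGroup.mk [x]) = signedVal w x := by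
          rw [hmk, ← FreeGroup.one_eq_mk, map_one, mul_one]
        rw [h1]
        refine ⟨le_trans (by positivity) (hsum x), ?_⟩
        simp
      | cons y L =>
        obtain ⟨ihS, ihT⟩ := ih (isReduced_of_isInfix hL ⟨[x], [], by simp⟩)
        specialize ihT y (by simp)
        rw [hmk]
        set R := FreeGroup.lift w (FreeGroup.mk (y :: L))
        obtain ⟨p, q, s, h₁, h₂, h₃⟩ := exists_toWord_mul (signedVal w x) R
        have hq : q.length < t := by
          by_contra! hq
          have h4 : (signedVal w (x.1, !x.2)).toWord = FreeGroup.invRev q ++ FreeGroup.invRev p := by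
            rw [signedVal_not, FreeGroup.toWord_inv, h₁, FreeGroup.invRev_append]
          have h5 := hdist (x.1, !x.2) y (by
            rw [← ihT, h4, h₂, List.take_append_of_le_length, List.take_append_of_le_length] <;>
            simpa using hq)
          have h6 := (FreeGroup.isReduced_cons_cons.1 hL).1
          subst h5
          simp at h6
        have hx := hlen x
        have hS := hsum x
        rw [h₁] at hx hS
        rw [h₂] at ihS
        rw [h₃]
        rw [List.length_append] at hx
        constructor
        · have a1 := abs_le.1 (abs_pairSum_append_sub_le hf hK p q)
          have a2 := abs_le.1 (abs_pairSum_append_sub_le hf hK (FreeGroup.invRev q) s)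
          have a3 := abs_le.1 (abs_pairSum_append_sub_le hf hK p s)
          have a4 := abs_le.1 (abs_pairSum_le hf hK q)
          have a5 := abs_le.1 (abs_pairSum_le hf hK (FreeGroup.invRev q))
          rw [FreeGroup.invRev_length] at a5
          have a6 : K * q.length ≤ K * t := by gcongr
          linarith [a1.2, a2.2, a3.1, a4.2, a5.2]
        · simp only [List.head?_cons, Option.mem_def, Option.some.injEq, forall_eq']
          rw [h₁, List.take_append_of_le_length (by omega), List.take_append_of_le_length (by omega)]
  have := (key y.toWord FreeGroup.isReduced_toWord).1
  rwa [FreeGroup.mk_toWord] at this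

end Cancellation

section Whitehead

variable {k : ℕ}

@[simp] lemma invL_invL (x : Fin k × Bool) : invL (invL x) = x := by simp [invL]

lemma invL_ne (x : Fin k × Bool) : invL x ≠ x := by simp [invL, Prod.ext_iff]

lemma eq_invL_comm {x y : Fin k × Bool} : x = invL y ↔ invL x = y :=
  ⟨fun h => by simp [h], fun h => by simp [← h]⟩

lemma isReduced_cons_iff_ne_invL {x : Fin k × Bool} {l : List (Fin k × Bool)} :
    FreeGroup.IsReduced (x :: l) ↔ (∀ y ∈ l.head?, y ≠ invL x) ∧ FreeGroup.IsReduced l := by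
  cases l with
  | nil => simp
  | cons y l =>
    rw [FreeGroup.isReduced_cons_cons]
    obtain ⟨i, b⟩ := x
    obtain ⟨j, c⟩ := y
    simp only [invL, List.head?_cons, Option.mem_def, Option.some.injEq, forall_eq', ne_eq,
      Prod.mk.injEq, not_and, Bool.not_eq_not, and_congr_left_iff]
    exact fun _ => ⟨fun h h' => (h h'.symm).symm, fun h h' => (h h'.symm).symm⟩

/-- The edge `{x, y⁻¹}` of the Whitehead graph crosses the cut `(A, Aᶜ)`. -/
def crossing (A : Set (Fin k × Bool)) (x y : Fin k × Bool) : ℝ :=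
  |(if x ∈ A then 1 else 0) - (if invL y ∈ A then 1 else 0)|

/-- The change of length caused by `φ_{(A,a)}` at the pair of consecutive letters `x, y`. -/
def whiteheadWeight (A : Set (Fin k × Bool)) (a : Fin k × Bool) (x y : Fin k × Bool) : ℝ :=
  crossing A x y - if x = a ∨ x = invL a then 1 else 0

/-- The letter `x`, erased if it is `a` or `a⁻¹`. -/
def hatL (a x : Fin k × Bool) : List (Fin k × Bool) := if x = a ∨ x = invL a then [] else [x]

/-- The power of `a` which `φ_{(A,a)}` creates between the letters `x` and `y`. -/
def junction (A : Set (Fin k × Bool)) (a x y : Fin k × Bool) : List (Fin k × Bool) :=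
  if x ∈ A then if invL y ∈ A then [] else [a] else if invL y ∈ A then [invL a] else []

/-- The image of a reduced word under `φ_{(A,a)}`, up to a power of `a` on the left. -/
def whiteheadWord (A : Set (Fin k × Bool)) (a : Fin k × Bool) :
    List (Fin k × Bool) → List (Fin k × Bool)
  | [] => []
  | [x] => hatL a x ++ if x ∈ A then [a] else []
  | x :: y :: l => hatL a x ++ (junction A a x y ++ whiteheadWord A a (y :: l))

variable {A : Set (Fin k × Bool)} {a : Fin k × Bool}

lemma mk_invL (x : Fin k × Bool) : FreeGroup.mk [invL x] = (FreeGroup.mk [x])⁻¹ := by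
  simp [FreeGroup.inv_mk, FreeGroup.invRev, invL]

/-- The power `a` or `1` according to a condition. -/
def condL (a : Fin k × Bool) (P : Prop) : FreeGroup (Fin k) := if P then FreeGroup.mk [a] else 1

lemma whiteheadAut_mk_singleton (ha : a ∈ A) (ha' : invL a ∉ A) (x : Fin k × Bool) :
    whiteheadAut k A a (FreeGroup.mk [x]) =
      (condL a (invL x ∈ A))⁻¹ * FreeGroup.mk (hatL a x) * condL a (x ∈ A) := by
  have pos : ∀ i : Fin k, whiteheadAut k A a (FreeGroup.mk [(i, true)]) =
      (condL a (invL (i, true) ∈ A))⁻¹ * FreeGroup.mk (hatL a (i, true)) *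
        condL a ((i, true) ∈ A) := by
    intro i
    have h : whiteheadAut k A a (FreeGroup.mk [(i, true)]) = _ := FreeGroup.lift_apply_of
    rw [h]
    by_cases h1 : (i, true) = a
    · simp [h1, condL, hatL, ha, ha', ← FreeGroup.one_eq_mk]
      simp [← h1, FreeGroup.of]
    by_cases h2 : (i, true) = invL a
    · have h3 : a = invL (i, true) := by simp [h2]
      have h4 : FreeGroup.of i = (FreeGroup.mk [a])⁻¹ := by rw [← mk_invL, ← h2]; rfl
      simp [h2, condL, hatL, ha, ha', ← FreeGroup.one_eq_mk, h4]
    · simp only [h1, h2, or_false, if_false, hatL, condL]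
      split_ifs <;> simp [FreeGroup.of]
  obtain ⟨i, _ | _⟩ := x
  · have h : ((i, false) : Fin k × Bool) = invL (i, true) := rfl
    have h5 : FreeGroup.mk (hatL a (invL (i, true))) = (FreeGroup.mk (hatL a (i, true)))⁻¹ := by
      simp only [hatL, eq_invL_comm (y := a), invL_invL, or_comm]
      split_ifs
      · simp [← FreeGroup.one_eq_mk]
      · exact mk_invL _
    rw [h, mk_invL, map_inv, pos, h5, invL_invL]
    group
  · exact pos i

lemma junction_mul (x y : Fin k × Bool) :
    condL a (x ∈ A) * (condL a (invL y ∈ A))⁻¹ = FreeGroup.mk (junction A a x y) := by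
  simp only [condL, junction]
  split_ifs <;> simp only [mk_invL, ← FreeGroup.one_eq_mk, mul_inv_cancel, inv_one, mul_one,
    one_mul]

lemma whiteheadAut_mk_cons (ha : a ∈ A) (ha' : invL a ∉ A) (x : Fin k × Bool)
    (l : List (Fin k × Bool)) :
    whiteheadAut k A a (FreeGroup.mk (x :: l)) =
      (condL a (invL x ∈ A))⁻¹ * FreeGroup.mk (whiteheadWord A a (x :: l)) := by
  induction l generalizing x with
  | nil =>
    rw [whiteheadAut_mk_singleton ha ha', whiteheadWord, ← FreeGroup.mul_mk, mul_assoc]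
    congr 2
    rw [condL]
    split_ifs <;> rfl
  | cons y l ih =>
    have h : FreeGroup.mk (x :: y :: l) = FreeGroup.mk [x] * FreeGroup.mk (y :: l) := by
      simp
    rw [h, map_mul, ih, whiteheadAut_mk_singleton ha ha', whiteheadWord, ← FreeGroup.mul_mk,
      ← FreeGroup.mul_mk, ← junction_mul]
    group

lemma isReduced_whiteheadWord (ha : a ∈ A) (ha' : invL a ∉ A) (x : Fin k × Bool)
    (l : List (Fin k × Bool)) (hl : FreeGroup.IsReduced (x :: l)) :
    FreeGroup.IsReduced (whiteheadWord A a (x :: l)) ∧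
      ∀ h ∈ (whiteheadWord A a (x :: l)).head?, h = x ∨
        ((x = a ∨ x = invL a) ∧ h ≠ a ∧ h ≠ invL a ∧ (invL h ∈ A ↔ x ∈ A)) := by
  induction l generalizing x with
  | nil =>
    simp only [whiteheadWord, hatL]
    by_cases h1 : x = a
    · simp [h1, ha]
    by_cases h2 : x = invL a
    · simp [h2, ha']
    · have h3 : a ≠ invL x := fun h => h2 (by simp [h])
      simp only [h1, h2, or_false, if_false]
      split_ifs <;> simp [isReduced_cons_iff_ne_invL, -FreeGroup.isReduced_cons_cons, h3]
  | cons y l ih =>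
    rw [isReduced_cons_iff_ne_invL] at hl
    have hy : y ≠ invL x := hl.1 y (by simp)
    obtain ⟨ih1, ih2⟩ := ih y hl.2
    rw [whiteheadWord]
    generalize whiteheadWord A a (y :: l) = W at *
    have inj : ∀ u v : Fin k × Bool, u = invL v → invL u = v := fun u v => eq_invL_comm.1
    have hinv : ∀ u : Fin k × Bool, invL (invL u) = u := invL_invL
    have hne : ∀ u : Fin k × Bool, invL u ≠ u := invL_ne
    simp only [hatL, junction]
    split_ifs with c1 c2 c3 c3 c2 c3 c3 <;>
      simp only [List.nil_append, List.cons_append, isReduced_cons_iff_ne_invL, List.head?_cons,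
        Option.mem_def, Option.some.injEq, forall_eq', ih1, and_true] <;>
      grind

lemma length_whiteheadWord (x : Fin k × Bool) (l : List (Fin k × Bool)) :
    (l.length : ℝ) + pairSum (whiteheadWeight A a) (x :: l) ≤
      (whiteheadWord A a (x :: l)).length := by
  induction l generalizing x with
  | nil => simp [pairSum]
  | cons y l ih =>
    have h : ((hatL a x).length : ℝ) + (junction A a x y).length =
        1 + whiteheadWeight A a x y := by
      simp only [hatL, junction, whiteheadWeight, crossing]
      split_ifs <;> norm_num
    rw [pairSum, whiteheadWord, List.length_append, List.length_append, List.length_cons]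
    push_cast
    linarith [ih y]

lemma wlen_eq_norm (g : FreeGroup (Fin k)) : wlen g = g.norm := rfl

lemma wlen_mul_le (g h : FreeGroup (Fin k)) : wlen (g * h) ≤ wlen g + wlen h :=
  FreeGroup.norm_mul_le g h

lemma wlen_inv (g : FreeGroup (Fin k)) : wlen g⁻¹ = wlen g := FreeGroup.norm_inv_eq

/-- `φ_{(A,a)}` changes the length of a word at least by the sum of the weights of its pairs of
consecutive letters, up to an additive constant. -/
lemma le_wlen_whiteheadAut (ha : a ∈ A) (ha' : invL a ∉ A) (g : FreeGroup (Fin k)) :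
    (wlen g : ℝ) + pairSum (whiteheadWeight A a) g.toWord - 2 ≤ wlen (whiteheadAut k A a g) := by
  rcases hg : g.toWord with _ | ⟨x, l⟩
  · have : wlen g = 0 := by simp [wlen, hg]
    simp only [this, pairSum]
    have : (0 : ℝ) ≤ wlen (whiteheadAut k A a g) := by positivity
    push_cast
    linarith
  · have h1 := length_whiteheadWord (A := A) (a := a) x l
    have hred : FreeGroup.IsReduced (x :: l) := hg ▸ FreeGroup.isReduced_toWord
    have h2 := (isReduced_whiteheadWord ha ha' x l hred).1
    have h3 := whiteheadAut_mk_cons ha ha' x l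
    rw [← hg, FreeGroup.mk_toWord, hg] at h3
    have h4 : wlen (FreeGroup.mk (whiteheadWord A a (x :: l))) =
        (whiteheadWord A a (x :: l)).length := by
      rw [wlen, FreeGroup.toWord_mk, h2.reduce_eq]
    have h5 : wlen (condL a (invL x ∈ A)) ≤ 1 := by
      rw [condL]
      split_ifs
      · exact FreeGroup.norm_mk_le
      · simp [wlen]
    have h6 : FreeGroup.mk (whiteheadWord A a (x :: l)) =
        condL a (invL x ∈ A) * whiteheadAut k A a g := by rw [h3]; group
    have h7 := wlen_mul_le (condL a (invL x ∈ A)) (whiteheadAut k A a g)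
    rw [← h6, h4] at h7
    have h8 : ((whiteheadWord A a (x :: l)).length : ℝ) ≤ 1 + wlen (whiteheadAut k A a g) := by
      exact_mod_cast h7.trans (by gcongr)
    have h9 : wlen g = l.length + 1 := by simp [wlen, hg]
    rw [h9]
    push_cast
    linarith

end Whitehead

section Stable

variable {k : ℕ}

lemma wlen_pow_of_isCyclicallyReduced {r : FreeGroup (Fin k)} (hr : IsCyclicallyReduced r)
    (N : ℕ) : wlen (r ^ N) = N * wlen r := by
  have h1 : FreeGroup.IsReduced (r.toWord ++ r.toWord) := FreeGroup.isReduced_iff_reduce_eq.2 hr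
  have h2 : FreeGroup.IsCyclicallyReduced r.toWord := by
    rw [FreeGroup.IsReduced, List.isChain_append] at h1
    exact ⟨h1.1, h1.2.2⟩
  rw [wlen, FreeGroup.toWord_pow, (h2.flatten_replicate N).isReduced.reduce_eq]
  simp [wlen]

lemma wlen_pow_le (g : FreeGroup (Fin k)) (N : ℕ) : wlen (g ^ N) ≤ N * wlen g := by
  induction N with
  | zero => simp [wlen]
  | succ N ih =>
    rw [pow_succ]
    have := wlen_mul_le (g ^ N) g
    linarith

lemma exists_mk_rotate_eq (r : FreeGroup (Fin k)) (m : ℕ) :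
    ∃ d, FreeGroup.mk (r.toWord.rotate m) = d⁻¹ * r * d := by
  refine ⟨FreeGroup.mk (r.toWord.take (m % r.toWord.length)), ?_⟩
  rw [List.rotate_eq_drop_append_take_mod, ← FreeGroup.mul_mk, eq_comm, mul_assoc, inv_mul_eq_iff_eq_mul,
    ← mul_assoc, FreeGroup.mul_mk, List.take_append_drop, FreeGroup.mk_toWord]

/-- If an endomorphism stretches a subgroup by a factor `1 + η` up to an additive constant, then
it strictly increases the length of every cyclic permutation of the cyclic reduction of each
non-trivial element of the subgroup. -/
theorem wlen_rotate_lt_of_stretch (φ : FreeGroup (Fin k) →* FreeGroup (Fin k))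
    (H : Subgroup (FreeGroup (Fin k))) {η C : ℝ} (hη : 0 < η)
    (hφ : ∀ h ∈ H, (1 + η) * wlen h - C ≤ wlen (φ h)) {g c r : FreeGroup (Fin k)} (hg : g ∈ H)
    (hg1 : g ≠ 1) (hr : IsCyclicallyReduced r) (hgr : g = c * r * c⁻¹) (m : ℕ) :
    wlen (FreeGroup.mk (r.toWord.rotate m)) < wlen (φ (FreeGroup.mk (r.toWord.rotate m))) := by
  obtain ⟨d, hd⟩ := exists_mk_rotate_eq r m
  have hle : wlen (FreeGroup.mk (r.toWord.rotate m)) ≤ wlen r := by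
    have : wlen (FreeGroup.mk (r.toWord.rotate m)) ≤ _ := FreeGroup.norm_mk_le
    simpa [wlen] using this
  have hr1 : 1 ≤ wlen r := by
    rw [Nat.one_le_iff_ne_zero, wlen_eq_norm, Ne, FreeGroup.norm_eq_zero]
    rintro rfl
    simp [hgr] at hg1
  refine lt_of_le_of_lt hle ?_
  rw [hd]
  set g' := d⁻¹ * r * d with hg'
  obtain ⟨u, hu⟩ : ∃ u, ∀ N : ℕ, g ^ N = u * g' ^ N * u⁻¹ := by
    refine ⟨c * d, fun N => ?_⟩
    rw [← conj_pow, hgr, hg']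
    congr 1
    group
  have hc : ∀ N : ℕ, r ^ N = c⁻¹ * g ^ N * c := by
    intro N
    have : c⁻¹ * g ^ N * c = c⁻¹ * g ^ N * c⁻¹⁻¹ := by rw [inv_inv]
    rw [this, ← conj_pow, hgr]
    congr 1
    group
  by_contra! hcon
  have hconR : (wlen (φ g') : ℝ) ≤ wlen r := by exact_mod_cast hcon
  have hrR : (1 : ℝ) ≤ wlen r := by exact_mod_cast hr1
  set D : ℝ := 2 * wlen (φ u) + C + (1 + η) * (2 * wlen c) with hD
  have main : ∀ N : ℕ, N * η ≤ D := by
    intro N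
    have h1 : (wlen (φ (g ^ N)) : ℝ) ≤ 2 * wlen (φ u) + N * wlen (φ g') := by
      rw [hu, map_mul, map_mul, map_inv, map_pow]
      have e1 := wlen_mul_le (φ u * φ g' ^ N) (φ u)⁻¹
      have e2 := wlen_mul_le (φ u) (φ g' ^ N)
      have e3 := wlen_pow_le (φ g') N
      rw [wlen_inv] at e1
      have : wlen (φ u * φ g' ^ N * (φ u)⁻¹) ≤ 2 * wlen (φ u) + N * wlen (φ g') := by linarith
      exact_mod_cast this
    have h2 : (N : ℝ) * wlen r ≤ 2 * wlen c + wlen (g ^ N) := by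
      have e1 := wlen_mul_le (c⁻¹ * g ^ N) c
      have e2 := wlen_mul_le c⁻¹ (g ^ N)
      rw [wlen_inv] at e2
      rw [← hc, wlen_pow_of_isCyclicallyReduced hr] at e1
      have : N * wlen r ≤ 2 * wlen c + wlen (g ^ N) := by linarith
      exact_mod_cast this
    have h3 := hφ _ (H.pow_mem hg N)
    have h4 : (1 + η) * ((N : ℝ) * wlen r) ≤ (1 + η) * (2 * wlen c + wlen (g ^ N)) := by gcongr
    have h5 : (N : ℝ) * wlen (φ g') ≤ N * wlen r := by gcongr
    have h6 : (N : ℝ) * η * 1 ≤ N * η * wlen r := by gcongr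
    rw [hD]
    linarith
  obtain ⟨N, hN⟩ := exists_nat_gt (D / η)
  have := main N
  rw [div_lt_iff₀ hη] at hN
  linarith

end Stable

section Weight

variable {k : ℕ}

lemma sum_invL (F : Fin k × Bool → ℝ) : ∑ y, F (invL y) = ∑ y, F y :=
  Fintype.sum_equiv (Function.Involutive.toPerm invL invL_invL) _ _ fun _ => rfl

lemma sum_ne_invL (F : Fin k × Bool → ℝ) (x : Fin k × Bool) :
    ∑ y with y ≠ invL x, F y = ∑ y, F y - F (invL x) := by
  rw [Finset.filter_ne', ← Finset.add_sum_erase _ F (Finset.mem_univ (invL x))]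
  ring

/-- After subtraction of a small constant and addition of a coboundary, the weight of a Whitehead
automorphism which is not obviously inner has uniformly positive conditional expectations along
the non-backtracking random walk. -/
lemma exists_coboundary_whiteheadWeight (hk : 2 ≤ k) (A : Set (Fin k × Bool)) (a : Fin k × Bool)
    (h2 : 2 ≤ A.ncard) (h2' : A.ncard + 2 ≤ 2 * k) :
    ∃ b : Fin k × Bool → ℝ, ∀ x, 1 / (2 * (k : ℝ)) ≤ ∑ y with y ≠ invL x,
      (whiteheadWeight A a x y - 1 / (2 * k * (2 * k - 1)) + b y - b x) := by
  have hkR : (2 : ℝ) ≤ k := by exact_mod_cast hk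
  set m : ℝ := (A.ncard : ℝ) with hm
  have hm1 : (2 : ℝ) ≤ m := by rw [hm]; exact_mod_cast h2
  have hm2 : m + 2 ≤ 2 * (k : ℝ) := by rw [hm]; exact_mod_cast h2'
  set u : Fin k × Bool → ℝ := fun x => if x ∈ A then 1 else 0 with hu
  set z : Fin k × Bool → ℝ := fun x => if x = a ∨ x = invL a then 1 else 0 with hz
  have hzinv : ∀ x, z (invL x) = z x := by
    intro x
    simp only [hz, eq_invL_comm (y := a), invL_invL, or_comm]
  have hsu : ∑ y, u y = m := by
    simp only [hu, Finset.sum_boole, hm]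
    rw [Set.filter_mem_univ_eq_toFinset, ← Set.ncard_eq_toFinset_card']
  have hsz : ∑ y, z y = 2 := by
    have : ∀ y, z y = (if y = a then 1 else 0) + (if y = invL a then 1 else 0) := by
      intro y
      simp only [hz]
      by_cases h : y = a
      · simp [h, (invL_ne a).symm]
      · simp [h]
    simp only [this, Finset.sum_add_distrib]
    norm_num
  have hcross : ∀ x y, crossing A x y = u x + u (invL y) - 2 * u x * u (invL y) := by
    intro x y
    simp only [crossing, hu]
    split_ifs <;> norm_num
  set q : ℝ := 2 * k - 1 with hq
  set s' : ℝ := -(2 * k - 2 * m) / (q ^ 2 - 1) with hs'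
  set s : ℝ := q * (2 * k - 2 * m) / (q ^ 2 - 1) with hs
  set r : ℝ := - q / (2 * k) with hr
  set b : Fin k × Bool → ℝ := fun x => s * u x + s' * u (invL x) + r * z x with hb
  refine ⟨b, fun x => ?_⟩
  have hsb : ∑ y, b y = (s + s') * m + 2 * r := by
    simp only [hb, Finset.sum_add_distrib, ← Finset.mul_sum, sum_invL, hsu, hsz]
    ring
  have hcard : ∀ c : ℝ, ∑ _y : Fin k × Bool, c = 2 * k * c := by
    intro c
    rw [Finset.sum_const, Finset.card_univ, Fintype.card_prod, Fintype.card_fin, Fintype.card_bool,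
      nsmul_eq_mul]
    push_cast
    ring
  have hux : u x * u x = u x := by simp only [hu]; split_ifs <;> norm_num
  have hw : ∀ y, whiteheadWeight A a x y = u x + u (invL y) - 2 * u x * u (invL y) - z x := by
    intro y
    rw [whiteheadWeight, hcross]
  rw [sum_ne_invL]
  simp only [hw, Finset.sum_add_distrib, Finset.sum_sub_distrib, ← Finset.mul_sum, sum_invL, hsu,
    hsb, hcard, invL_invL]
  simp only [hb, hzinv, invL_invL]
  have hq1 : q ^ 2 - 1 = (2 * k) * (2 * (k - 1)) := by rw [hq]; ring
  have hk1 : (k : ℝ) - 1 ≠ 0 := by linarith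
  have hq0 : 0 < q := by linarith
  have hfin : (m * (2 * k - m) - q) / k - 1 / (2 * k) ≥ 1 / (2 * (k : ℝ)) := by
    rw [ge_iff_le, ← sub_nonneg]
    have : (m * (2 * k - m) - q) / k - 1 / (2 * k) - 1 / (2 * (k : ℝ)) =
      (m * (2 * k - m) - q - 1) / k := by field_simp; ring
    rw [this]
    apply div_nonneg _ (by linarith)
    nlinarith [mul_nonneg (sub_nonneg.2 hm1) (sub_nonneg.2 hm2)]
  refine hfin.le.trans (le_of_eq ?_)
  have e : ∀ U V Z : ℝ, U * U = U → (m * (2 * k - m) - q) / k - 1 / (2 * k) =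
      2 * k * U + m - 2 * U * m - 2 * k * Z - 2 * k * (1 / (2 * k * q)) +
        ((s + s') * m + 2 * r) - 2 * k * (s * U + s' * V + r * Z) -
        (U + U - 2 * U * U - Z - 1 / (2 * k * q) + (s * V + s' * U + r * Z) -
          (s * U + s' * V + r * Z)) := by
    intro U V Z hU
    have : 2 * U * U = 2 * U := by rw [mul_assoc, hU]
    rw [this, hs, hs', hr, hq1]
    field_simp
    rw [hq]
    ring
  exact e _ _ _ hux

end Weight

section Inner

variable {k : ℕ} {A : Set (Fin k × Bool)} {a : Fin k × Bool}

lemma whiteheadAut_singleton_eq_id : whiteheadAut k {a} a = MonoidHom.id _ := by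
  refine FreeGroup.ext_hom _ _ fun i => ?_
  have h := whiteheadAut_mk_singleton (A := {a}) (a := a) rfl (invL_ne a) (i, true)
  rw [show FreeGroup.of i = FreeGroup.mk [(i, true)] from rfl, h, MonoidHom.id_apply]
  simp only [condL, hatL, Set.mem_singleton_iff, eq_invL_comm (y := a)]
  by_cases h1 : (i, true) = a
  · have h2 : invL (i, true) ≠ a := h1 ▸ invL_ne _
    rw [if_neg h2, if_pos (Or.inl h1), if_pos h1, ← FreeGroup.one_eq_mk, h1]
    group
  · by_cases h2 : invL (i, true) = a
    · rw [if_pos h2, if_pos (Or.inr h2), if_neg h1, ← FreeGroup.one_eq_mk, ← h2, mk_invL]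
      group
    · rw [if_neg h2, if_neg (by tauto), if_neg h1]
      group

lemma whiteheadAut_compl_singleton (y : FreeGroup (Fin k)) :
    whiteheadAut k {invL a}ᶜ a y = (FreeGroup.mk [a])⁻¹ * y * (FreeGroup.mk [a])⁻¹⁻¹ := by
  suffices h : whiteheadAut k {invL a}ᶜ a = (MulAut.conj (FreeGroup.mk [a])⁻¹).toMonoidHom by
    rw [h]; rfl
  refine FreeGroup.ext_hom _ _ fun i => ?_
  have h := whiteheadAut_mk_singleton (A := {invL a}ᶜ) (a := a) (invL_ne a).symm
    (by simp) (i, true)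
  rw [show FreeGroup.of i = FreeGroup.mk [(i, true)] from rfl, h]
  simp only [condL, hatL, Set.mem_compl_iff, Set.mem_singleton_iff, eq_invL_comm (y := a),
    invL_invL, MulEquiv.coe_toMonoidHom, MulAut.conj_apply]
  by_cases h1 : (i, true) = a
  · have h2 : invL (i, true) ≠ a := h1 ▸ invL_ne _
    simp only [h1, not_true_eq_false, if_false, true_or, if_true, ← FreeGroup.one_eq_mk]
    rw [h1] at h2
    simp [h2, -FreeGroup.inv_mk, -FreeGroup.mul_mk]
  · by_cases h2 : invL (i, true) = a
    · have h3 : (i, true) = invL a := eq_invL_comm.2 h2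
      have h4 : a ≠ invL a := (invL_ne a).symm
      simp only [h3, invL_invL, h4.symm, mk_invL]
      simp [-FreeGroup.inv_mk, -FreeGroup.mul_mk, ← FreeGroup.one_eq_mk]
    · simp [h1, h2]

lemma ncard_bounds_of_not_inner (ha : a ∈ A) (ha' : invL a ∉ A)
    (hA : ¬ ∃ z : FreeGroup (Fin k), ∀ y, whiteheadAut k A a y = z * y * z⁻¹) :
    2 ≤ A.ncard ∧ A.ncard + 2 ≤ 2 * k := by
  constructor
  · by_contra! h
    have hpos : 0 < A.ncard := (Set.ncard_pos (Set.toFinite _)).2 ⟨a, ha⟩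
    obtain ⟨b, rfl⟩ := Set.ncard_eq_one.1 (show A.ncard = 1 by omega)
    obtain rfl : a = b := ha
    exact hA ⟨1, fun y => by simp [whiteheadAut_singleton_eq_id]⟩
  · by_contra! h
    have hsub : A ⊆ {invL a}ᶜ := by
      intro x hx hxa
      exact ha' (hxa ▸ hx)
    have hcard : ({invL a}ᶜ : Set (Fin k × Bool)).ncard + 1 = 2 * k := by
      have := Set.ncard_add_ncard_compl ({invL a} : Set (Fin k × Bool))
      rw [Set.ncard_singleton] at this
      simp only [Nat.card_eq_fintype_card, Fintype.card_prod, Fintype.card_fin,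
        Fintype.card_bool] at this
      omega
    have : A = {invL a}ᶜ := Set.eq_of_subset_of_ncard_le hsub (by omega)
    exact hA ⟨_, fun y => this ▸ whiteheadAut_compl_singleton y⟩

end Inner

section Counting

variable {k : ℕ}

/-- The reduced words of length `m + 1` which begin with the letter `x`. -/
def redWords : ℕ → Fin k × Bool → Finset (List (Fin k × Bool))
  | 0, x => {[x]}
  | m + 1, x => (Finset.univ.filter (· ≠ invL x)).biUnion fun y => (redWords m y).image (x :: ·)

lemma mem_redWords {m : ℕ} {x : Fin k × Bool} {u : List (Fin k × Bool)} :
    u ∈ redWords m x ↔ u.length = m + 1 ∧ u.head? = some x ∧ FreeGroup.IsReduced u := by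
  induction m generalizing x u with
  | zero =>
    rw [redWords, Finset.mem_singleton]
    constructor
    · rintro rfl
      simp
    · rintro ⟨h1, h2, -⟩
      obtain ⟨z, rfl⟩ := List.length_eq_one_iff.1 h1
      simpa using h2
  | succ m ih =>
    simp only [redWords, Finset.mem_biUnion, Finset.mem_filter, Finset.mem_univ, true_and,
      Finset.mem_image, ih]
    constructor
    · rintro ⟨y, hy, l, ⟨h1, h2, h3⟩, rfl⟩
      refine ⟨by simp [h1], rfl, isReduced_cons_iff_ne_invL.2 ⟨?_, h3⟩⟩
      intro z hz
      rw [h2] at hz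
      simp only [Option.mem_def, Option.some.injEq] at hz
      exact hz ▸ hy
    · rintro ⟨h1, h2, h3⟩
      rcases u with _ | ⟨x', _ | ⟨y, l⟩⟩
      · simp at h1
      · simp at h1
      · simp only [List.head?_cons, Option.some.injEq] at h2
        subst h2
        rw [isReduced_cons_iff_ne_invL] at h3
        exact ⟨y, h3.1 y rfl, y :: l, ⟨by simpa using h1, rfl, h3.2⟩, rfl⟩

/-- The reduced words of length `m + 1`. -/
def sphere (k m : ℕ) : Finset (List (Fin k × Bool)) := Finset.univ.biUnion (redWords m)

lemma mem_sphere {m : ℕ} {u : List (Fin k × Bool)} :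
    u ∈ sphere k m ↔ u.length = m + 1 ∧ FreeGroup.IsReduced u := by
  simp only [sphere, Finset.mem_biUnion, Finset.mem_univ, true_and, mem_redWords]
  constructor
  · rintro ⟨x, h1, -, h3⟩
    exact ⟨h1, h3⟩
  · rintro ⟨h1, h2⟩
    cases u with
    | nil => simp at h1
    | cons x l => exact ⟨x, h1, rfl, h2⟩

lemma disjoint_redWords (m : ℕ) {x y : Fin k × Bool} (hxy : x ≠ y) :
    Disjoint (redWords m x) (redWords m y) := by
  rw [Finset.disjoint_left]
  intro u hu hu'
  rw [mem_redWords] at hu hu'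
  exact hxy (Option.some.inj (hu.2.1.symm.trans hu'.2.1))

lemma sum_redWords_succ (F : List (Fin k × Bool) → ℝ) (m : ℕ) (x : Fin k × Bool) :
    ∑ u ∈ redWords (m + 1) x, F u = ∑ y with y ≠ invL x, ∑ u ∈ redWords m y, F (x :: u) := by
  rw [redWords, Finset.sum_biUnion]
  · refine Finset.sum_congr rfl fun y _ => ?_
    rw [Finset.sum_image fun u _ v _ h => (List.cons.inj h).2]
  · intro y _ z _ hyz
    exact (Finset.disjoint_image (List.cons_injective)).2 (disjoint_redWords m hyz)

lemma sum_sphere (F : List (Fin k × Bool) → ℝ) (m : ℕ) :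
    ∑ u ∈ sphere k m, F u = ∑ x, ∑ u ∈ redWords m x, F u := by
  rw [sphere, Finset.sum_biUnion]
  intro y _ z _ hyz
  exact disjoint_redWords m hyz

lemma card_ne_invL (x : Fin k × Bool) :
    ((Finset.univ.filter (· ≠ invL x)).card : ℝ) = 2 * k - 1 := by
  have := sum_ne_invL (fun _ => 1) x
  simp only [Finset.sum_const, nsmul_eq_mul, mul_one, Finset.card_univ, Fintype.card_prod,
    Fintype.card_fin, Fintype.card_bool] at this
  rw [this]
  push_cast
  ring

lemma sum_redWords_exp_le {f : Fin k × Bool → Fin k × Bool → ℝ} {c d : ℝ} (hd : 0 ≤ d)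
    (hf : ∀ x, ∑ y with y ≠ invL x, Real.exp (-(c * f x y)) ≤ d) (m : ℕ) (x : Fin k × Bool) :
    ∑ u ∈ redWords m x, Real.exp (-(c * pairSum f u)) ≤ d ^ m := by
  induction m generalizing x with
  | zero => simp [redWords, pairSum]
  | succ m ih =>
    have hcons : ∀ y, ∀ u ∈ redWords m y, Real.exp (-(c * pairSum f (x :: u))) =
        Real.exp (-(c * f x y)) * Real.exp (-(c * pairSum f u)) := by
      intro y u hu
      rw [mem_redWords] at hu
      cases u with
      | nil => simp at hu
      | cons z l =>
        obtain rfl : z = y := by simpa using hu.2.1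
        rw [pairSum, ← Real.exp_add]
        ring_nf
    calc _ = ∑ y with y ≠ invL x, Real.exp (-(c * f x y)) *
          ∑ u ∈ redWords m y, Real.exp (-(c * pairSum f u)) := by
          rw [sum_redWords_succ]
          refine Finset.sum_congr rfl fun y _ => ?_
          rw [Finset.mul_sum]
          exact Finset.sum_congr rfl (hcons y)
      _ ≤ ∑ y with y ≠ invL x, Real.exp (-(c * f x y)) * d ^ m := by
          gcongr with y
          exact ih y
      _ = (∑ y with y ≠ invL x, Real.exp (-(c * f x y))) * d ^ m := by rw [Finset.sum_mul]
      _ ≤ d * d ^ m := by gcongr; exact hf x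
      _ = d ^ (m + 1) := by ring

lemma card_sphere (m : ℕ) : ((sphere k m).card : ℝ) = 2 * k * (2 * k - 1) ^ m := by
  have h : ∀ x : Fin k × Bool, ((redWords m x).card : ℝ) = (2 * k - 1) ^ m := by
    induction m with
    | zero => simp [redWords]
    | succ m ih =>
      intro x
      have := sum_redWords_succ (fun _ => 1) m x
      simp only [Finset.sum_const, nsmul_eq_mul, mul_one, ih, card_ne_invL] at this
      rw [this]
      ring
  have := sum_sphere (k := k) (fun _ => 1) m
  simp only [Finset.sum_const, nsmul_eq_mul, mul_one, h, Finset.card_univ, Fintype.card_prod,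
    Fintype.card_fin, Fintype.card_bool] at this
  rw [this]
  push_cast
  ring

/-- Large deviations: few reduced words have a small pair sum when the weight has positive
conditional expectations. -/
lemma card_pairSum_lt_le {f : Fin k × Bool → Fin k × Bool → ℝ} {K c : ℝ} (hk : 2 ≤ k)
    (hK : 1 ≤ K) (hf : ∀ x y, |f x y| ≤ K) (hc : 0 < c)
    (hfc : ∀ x, c ≤ ∑ y with y ≠ invL x, f x y) (m t : ℕ) :
    (((sphere k m).filter fun u => pairSum f u < K * (2 * t + 3)).card : ℝ) ≤
      Real.exp (t + 2 - c ^ 2 / (4 * (2 * k - 1) ^ 2 * K ^ 2) * m) * (sphere k m).card := by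
  have hkR : (2 : ℝ) ≤ k := by exact_mod_cast hk
  set q : ℝ := 2 * k - 1 with hq
  have hq0 : 0 < q := by linarith
  have hK0 : 0 < K := by linarith
  set s : ℝ := c / (2 * q * K ^ 2) with hs
  set σ : ℝ := c ^ 2 / (4 * q ^ 2 * K ^ 2) with hσ
  have hs0 : 0 < s := by positivity
  have hcq : c ≤ q * K := by
    refine (hfc (⟨0, by omega⟩, true)).trans ?_
    rw [hq, ← card_ne_invL (⟨0, by omega⟩, true), ← nsmul_eq_mul]
    exact Finset.sum_le_card_nsmul _ _ _ fun y _ => (le_abs_self _).trans (hf _ _)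
  have hsK : s * K ≤ 1 / 2 := by
    rw [hs, div_mul_eq_mul_div, div_le_iff₀ (by positivity)]
    nlinarith
  have hexp : ∀ x, ∑ y with y ≠ invL x, Real.exp (-(s * f x y)) ≤ q * Real.exp (-σ) := by
    intro x
    have h1 : ∀ y, Real.exp (-(s * f x y)) ≤ 1 - s * f x y + s ^ 2 * K ^ 2 := by
      intro y
      have h2 : |s * f x y| ≤ s * K := by
        rw [abs_mul, abs_of_pos hs0]
        gcongr
        exact hf x y
      have h3 : |-(s * f x y)| ≤ 1 := by rw [abs_neg]; linarith
      have h4 := (abs_le.1 (Real.abs_exp_sub_one_sub_id_le h3)).2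
      have h5 : (-(s * f x y)) ^ 2 ≤ (s * K) ^ 2 := by
        rw [neg_sq]
        exact sq_le_sq' (by linarith [neg_abs_le (s * f x y)]) ((le_abs_self _).trans h2)
      nlinarith
    calc _ ≤ ∑ y with y ≠ invL x, (1 - s * f x y + s ^ 2 * K ^ 2) :=
          Finset.sum_le_sum fun y _ => h1 y
      _ = q - s * ∑ y with y ≠ invL x, f x y + q * (s ^ 2 * K ^ 2) := by
          rw [Finset.sum_add_distrib, Finset.sum_sub_distrib, ← Finset.mul_sum, Finset.sum_const,
            Finset.sum_const, nsmul_eq_mul, nsmul_eq_mul, card_ne_invL, mul_one]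
      _ ≤ q - s * c + q * (s ^ 2 * K ^ 2) := by gcongr; exact hfc x
      _ = q * (1 - σ) := by
          rw [hs, hσ]
          field_simp
          ring
      _ ≤ q * Real.exp (-σ) := by
          gcongr
          linarith [Real.add_one_le_exp (-σ)]
  have hsum : ∑ u ∈ sphere k m, Real.exp (-(s * pairSum f u)) ≤
      Real.exp (-(σ * m)) * (sphere k m).card := by
    rw [sum_sphere, card_sphere]
    calc _ ≤ ∑ _x : Fin k × Bool, (q * Real.exp (-σ)) ^ m :=
          Finset.sum_le_sum fun x _ => sum_redWords_exp_le (by positivity) hexp m x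
      _ = _ := by
          rw [Finset.sum_const, Finset.card_univ, Fintype.card_prod, Fintype.card_fin,
            Fintype.card_bool, nsmul_eq_mul, mul_pow, ← Real.exp_nat_mul]
          rw [hq, mul_neg, mul_comm (m : ℝ) σ]
          push_cast
          ring
  have hmarkov : (((sphere k m).filter fun u => pairSum f u < K * (2 * t + 3)).card : ℝ) *
      Real.exp (-(t + 2)) ≤ ∑ u ∈ sphere k m, Real.exp (-(s * pairSum f u)) := by
    rw [← nsmul_eq_mul]
    refine (Finset.card_nsmul_le_sum _ _ _ fun u hu => ?_).trans
      (Finset.sum_le_sum_of_subset_of_nonneg (Finset.filter_subset _ _)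
        fun _ _ _ => (Real.exp_pos _).le)
    rw [Finset.mem_filter] at hu
    rw [Real.exp_le_exp, neg_le_neg_iff]
    calc s * pairSum f u ≤ s * (K * (2 * t + 3)) := by gcongr; exact hu.2.le
      _ = (s * K) * (2 * t + 3) := by ring
      _ ≤ 1 / 2 * (2 * t + 3) := by gcongr
      _ ≤ t + 2 := by linarith
  have := hmarkov.trans hsum
  rw [Real.exp_neg, ← div_eq_mul_inv, div_le_iff₀ (Real.exp_pos _)] at this
  refine this.trans_eq ?_
  rw [sub_eq_add_neg, Real.exp_add _ (-(σ * m))]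
  ring

lemma card_sphere_sub (hk : 2 ≤ k) {m t : ℕ} (h : t ≤ m) :
    ((sphere k (m - t)).card : ℝ) ≤ Real.exp (-t) * (sphere k m).card := by
  have hkR : (2 : ℝ) ≤ k := by exact_mod_cast hk
  rw [card_sphere, card_sphere, Real.exp_neg, inv_mul_eq_div, le_div_iff₀ (Real.exp_pos _)]
  have h1 : Real.exp t ≤ (2 * k - 1) ^ t := by
    rw [← mul_one (t : ℝ), Real.exp_nat_mul]
    gcongr
    linarith [Real.exp_one_lt_d9]
  have h2 : (0 : ℝ) ≤ 2 * k - 1 := by linarith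
  calc _ ≤ 2 * k * (2 * (k : ℝ) - 1) ^ (m - t) * (2 * k - 1) ^ t := by gcongr
    _ = _ := by rw [mul_assoc, ← pow_add, Nat.sub_add_cancel h]

lemma card_take_eq_le (hk : 2 ≤ k) {m t : ℕ} (h : t ≤ m) (v : List (Fin k × Bool)) :
    (((sphere k m).filter fun u => u.take t = v).card : ℝ) ≤
      Real.exp (-t) * (sphere k m).card := by
  refine le_trans ?_ (card_sphere_sub hk h)
  rw [Nat.cast_le]
  refine Finset.card_le_card_of_injOn (List.drop t) ?_ ?_
  · intro u hu
    simp only [Finset.coe_filter, Set.mem_ofPred_eq, mem_sphere] at hu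
    simp only [Finset.mem_coe, mem_sphere, List.length_drop]
    exact ⟨by omega, isReduced_of_isInfix hu.1.2 (List.drop_suffix t u).isInfix⟩
  · intro u hu u' hu' huu
    simp only [Finset.coe_filter, Set.mem_ofPred_eq] at hu hu'
    rw [← List.take_append_drop t u, ← List.take_append_drop t u', hu.2, hu'.2, huu]

lemma card_take_eq_take_invRev_le (hk : 2 ≤ k) {m t : ℕ} (h : 2 * t ≤ m) :
    (((sphere k m).filter fun u => u.take t = (FreeGroup.invRev u).take t).card : ℝ) ≤
      Real.exp (-t) * (sphere k m).card := by
  refine le_trans ?_ (card_sphere_sub hk (by omega))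
  rw [Nat.cast_le]
  have key : ∀ u ∈ (sphere k m).filter fun u => u.take t = (FreeGroup.invRev u).take t,
      u = u.take (m + 1 - t) ++ FreeGroup.invRev ((u.take (m + 1 - t)).take t) := by
    intro u hu
    rw [Finset.mem_filter, mem_sphere] at hu
    have h1 : (FreeGroup.invRev u).take t = FreeGroup.invRev (u.drop (m + 1 - t)) := by
      simp [FreeGroup.invRev, List.take_reverse, hu.1.1]
    rw [List.take_take, min_eq_left (by omega), hu.2, h1, FreeGroup.invRev_invRev,
      List.take_append_drop]
  refine Finset.card_le_card_of_injOn (List.take (m + 1 - t)) ?_ ?_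
  · intro u hu
    simp only [Finset.coe_filter, Set.mem_ofPred_eq, mem_sphere] at hu
    simp only [Finset.mem_coe, mem_sphere, List.length_take]
    exact ⟨by omega, isReduced_of_isInfix hu.1.2 ⟨[], _, List.take_append_drop _ u⟩⟩
  · intro u hu u' hu' huu
    rw [key u hu, key u' hu', huu]

end Counting

section Decay

lemma ExpDecay.mono {f g : ℕ → ENNReal} (hg : ExpDecay g) (h : ∀ n, f n ≤ g n) : ExpDecay f := by
  obtain ⟨C, hC, κ, hκ, H⟩ := hg
  exact ⟨C, hC, κ, hκ, fun n => (h n).trans (H n)⟩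

lemma ExpDecay.zero : ExpDecay fun _ => 0 := ⟨1, one_pos, 2, one_lt_two, fun _ => zero_le⟩

lemma ExpDecay.add {f g : ℕ → ENNReal} (hf : ExpDecay f) (hg : ExpDecay g) :
    ExpDecay fun n => f n + g n := by
  obtain ⟨C, hC, κ, hκ, H⟩ := hf
  obtain ⟨C', hC', κ', hκ', H'⟩ := hg
  have hmin : 1 < min κ κ' := lt_min hκ hκ'
  refine ⟨C + C', by positivity, min κ κ', hmin, fun n => ?_⟩
  have h0 : 0 < min κ κ' := by linarith
  calc f n + g n ≤ ENNReal.ofReal (C / κ ^ n) + ENNReal.ofReal (C' / κ' ^ n) :=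
        add_le_add (H n) (H' n)
    _ = ENNReal.ofReal (C / κ ^ n + C' / κ' ^ n) :=
        (ENNReal.ofReal_add (by positivity) (by positivity)).symm
    _ ≤ _ := by
      apply ENNReal.ofReal_le_ofReal
      rw [add_div]
      gcongr
      · exact min_le_left _ _
      · exact min_le_right _ _

lemma ExpDecay.sum {ι : Type*} {s : Finset ι} {f : ι → ℕ → ENNReal}
    (hf : ∀ i ∈ s, ExpDecay (f i)) : ExpDecay fun n => ∑ i ∈ s, f i n := by
  induction s using Finset.induction_on with
  | empty => simpa using ExpDecay.zero
  | insert i s hi ih =>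
    simp only [Finset.sum_insert hi]
    exact (hf i (by simp)).add (ih fun j hj => hf j (by simp [hj]))

lemma ExpDecay.of_le_exp {f : ℕ → ENNReal} {B δ : ℝ} (hδ : 0 < δ)
    (h : ∀ n : ℕ, f n ≤ ENNReal.ofReal (Real.exp (B - δ * n))) : ExpDecay f := by
  refine ⟨Real.exp B, Real.exp_pos _, Real.exp δ, Real.one_lt_exp_iff.2 hδ, fun n => ?_⟩
  refine (h n).trans_eq ?_
  rw [Real.exp_sub, ← Real.exp_nat_mul, mul_comm δ]

lemma ExpDecay.measure_union {Ω : Type*} [MeasurableSpace Ω] {ν : ℕ → Measure Ω}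
    {E F : ℕ → Set Ω} (hE : ExpDecay fun n => ν n (E n)) (hF : ExpDecay fun n => ν n (F n)) :
    ExpDecay fun n => ν n (E n ∪ F n) :=
  (hE.add hF).mono fun _ => MeasureTheory.measure_union_le _ _

lemma ExpDecay.measure_iUnion {Ω ι : Type*} [Finite ι] [MeasurableSpace Ω] {ν : ℕ → Measure Ω}
    {E : ι → ℕ → Set Ω} (hE : ∀ i, ExpDecay fun n => ν n (E i n)) :
    ExpDecay fun n => ν n (⋃ i, E i n) := by
  cases nonempty_fintype ι
  exact (ExpDecay.sum (s := Finset.univ) fun i _ => hE i).mono fun n =>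
    measure_iUnion_fintype_le _ _

end Decay

section Radial

variable {k : ℕ}

/-- The measure of a set of elements of the free group only depends on the word length. -/
def IsRadial (μ : Measure (FreeGroup (Fin k))) : Prop :=
  ∀ g g' : FreeGroup (Fin k), wlen g = wlen g' → μ {g} = μ {g'}

lemma measurableSet_freeGroup (s : Set (FreeGroup (Fin k))) : MeasurableSet s := trivial

lemma mk_injOn_sphere (m : ℕ) :
    Set.InjOn (FreeGroup.mk : List (Fin k × Bool) → FreeGroup (Fin k)) (sphere k m) := by
  intro u hu v hv h
  rw [Finset.mem_coe, mem_sphere] at hu hv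
  rw [← hu.2.reduce_eq, ← hv.2.reduce_eq, ← FreeGroup.toWord_mk, ← FreeGroup.toWord_mk, h]

/-- A radial probability measure gives small measure to a set which occupies a small proportion
of every sphere. -/
lemma IsRadial.measure_le {μ : Measure (FreeGroup (Fin k))} [IsProbabilityMeasure μ]
    (hμ : IsRadial μ) (B : Set (FreeGroup (Fin k))) {c : ℝ} (hc : 0 ≤ c)
    (hB : ∀ m, (((sphere k m).filter fun u => FreeGroup.mk u ∈ B).card : ℝ) ≤
      c * (sphere k m).card) (h1 : 1 ∉ B) :
    μ B ≤ ENNReal.ofReal c := by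
  set E : ℕ → Set (FreeGroup (Fin k)) := fun m => {g | wlen g = m + 1} with hE
  have hmem : ∀ m g, g ∈ E m ↔ g.toWord ∈ sphere k m := by
    intro m g
    rw [mem_sphere]
    exact ⟨fun h => ⟨h, FreeGroup.isReduced_toWord⟩, fun h => h.1⟩
  have hcount : ∀ m, ∃ e : ENNReal, ∀ C : Set (FreeGroup (Fin k)),
      μ (C ∩ E m) = ((sphere k m).filter fun u => FreeGroup.mk u ∈ C).card * e := by
    intro m
    obtain ⟨e, he⟩ : ∃ e : ENNReal, ∀ u ∈ sphere k m, μ {FreeGroup.mk u} = e := by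
      rcases (sphere k m).eq_empty_or_nonempty with h | ⟨v, hv⟩
      · exact ⟨0, by simp [h]⟩
      · refine ⟨μ {FreeGroup.mk v}, fun u hu => hμ _ _ ?_⟩
        rw [mem_sphere] at hu hv
        rw [wlen, wlen, FreeGroup.toWord_mk, FreeGroup.toWord_mk, hu.2.reduce_eq,
          hv.2.reduce_eq, hu.1, hv.1]
    refine ⟨e, fun C => ?_⟩
    have hset : C ∩ E m = ⋃ u ∈ (sphere k m).filter fun u => FreeGroup.mk u ∈ C,
        {FreeGroup.mk u} := by
      ext g
      simp only [Set.mem_inter_iff, hmem, Set.mem_iUnion, Finset.mem_filter,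
        Set.mem_singleton_iff, exists_prop]
      constructor
      · rintro ⟨h, h'⟩
        exact ⟨g.toWord, ⟨h', by rwa [FreeGroup.mk_toWord]⟩, FreeGroup.mk_toWord.symm⟩
      · rintro ⟨u, ⟨h, h'⟩, rfl⟩
        refine ⟨h', ?_⟩
        rwa [FreeGroup.toWord_mk, (mem_sphere.1 h).2.reduce_eq]
    rw [hset, measure_biUnion_finset _ fun _ _ => measurableSet_freeGroup _,
      Finset.sum_congr rfl fun u hu => he u (Finset.mem_filter.1 hu).1, Finset.sum_const,
      nsmul_eq_mul]
    intro u hu v hv huv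
    rw [Function.onFun, Set.disjoint_singleton]
    exact fun h => huv (mk_injOn_sphere m (Finset.mem_filter.1 hu).1 (Finset.mem_filter.1 hv).1 h)
  have hle : ∀ m, μ (B ∩ E m) ≤ ENNReal.ofReal c * μ (E m) := by
    intro m
    obtain ⟨e, he⟩ := hcount m
    have h2 := he Set.univ
    simp only [Set.univ_inter, Set.mem_univ, Finset.filter_true] at h2
    rw [he, h2, ← mul_assoc]
    gcongr
    rw [← ENNReal.ofReal_natCast, ← ENNReal.ofReal_natCast, ← ENNReal.ofReal_mul hc]
    exact ENNReal.ofReal_le_ofReal (hB m)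
  have hcover : B ⊆ ⋃ m, B ∩ E m := by
    intro g hg
    have h0 : wlen g ≠ 0 := by
      rw [wlen_eq_norm, Ne, FreeGroup.norm_eq_zero]
      rintro rfl
      exact h1 hg
    obtain ⟨m, hm⟩ := Nat.exists_eq_succ_of_ne_zero h0
    exact Set.mem_iUnion.2 ⟨m, hg, hm⟩
  calc μ B ≤ ∑' m, μ (B ∩ E m) := (measure_mono hcover).trans (measure_iUnion_le _)
    _ ≤ ∑' m, ENNReal.ofReal c * μ (E m) := ENNReal.tsum_le_tsum hle
    _ = ENNReal.ofReal c * μ (⋃ m, E m) := by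
        rw [ENNReal.tsum_mul_left, MeasureTheory.measure_iUnion _ fun _ => measurableSet_freeGroup _]
        intro i j hij
        rw [Function.onFun, Set.disjoint_left]
        intro g hg hg'
        simp only [hE, Set.mem_ofPred_eq] at hg hg'
        omega
    _ ≤ ENNReal.ofReal c := mul_le_of_le_one_right' prob_le_one

lemma IsRadial.map_inv {μ : Measure (FreeGroup (Fin k))} (hμ : IsRadial μ) :
    IsRadial (μ.map fun g => g⁻¹) := by
  have hmeas : Measurable fun g : FreeGroup (Fin k) => g⁻¹ := fun _ _ => trivial
  have hpre : ∀ g : FreeGroup (Fin k), (fun g => g⁻¹) ⁻¹' {g} = {g⁻¹} := by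
    intro g
    ext h
    simp
  intro g g' h
  rw [Measure.map_apply hmeas trivial, Measure.map_apply hmeas trivial, hpre, hpre]
  exact hμ _ _ (by rw [wlen_inv, wlen_inv, h])

lemma IsRadial.measure_cond_inv_le {μ : Measure (FreeGroup (Fin k))} [IsProbabilityMeasure μ]
    (hμ : IsRadial μ) (e : Bool) (B : Set (FreeGroup (Fin k))) {c : ℝ} (hc : 0 ≤ c)
    (hB : ∀ m, (((sphere k m).filter fun u => FreeGroup.mk u ∈ B).card : ℝ) ≤
      c * (sphere k m).card) (h1 : 1 ∉ B) :
    μ {g | cond e g g⁻¹ ∈ B} ≤ ENNReal.ofReal c := by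
  cases e
  · have hmeas : Measurable fun g : FreeGroup (Fin k) => g⁻¹ := fun _ _ => trivial
    have : IsProbabilityMeasure (μ.map fun g => g⁻¹) :=
      Measure.isProbabilityMeasure_map hmeas.aemeasurable
    refine le_trans (le_of_eq ?_) (hμ.map_inv.measure_le B hc hB h1)
    rw [Measure.map_apply hmeas trivial]
    rfl
  · exact hμ.measure_le B hc hB h1

/-- A condition on the words of a set of long elements yields a bound for its proportion in the
spheres, if it holds for the spheres of large radius. -/
lemma card_filter_mk_mem_le {R c : ℝ} (hc : 0 ≤ c) {P : List (Fin k × Bool) → Prop}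
    [DecidablePred P] {B : Set (FreeGroup (Fin k))} (m : ℕ)
    (hB : ∀ g ∈ B, R < wlen g ∧ P g.toWord)
    (h : R < m + 1 → (((sphere k m).filter P).card : ℝ) ≤ c * (sphere k m).card) :
    (((sphere k m).filter fun u => FreeGroup.mk u ∈ B).card : ℝ) ≤ c * (sphere k m).card := by
  have hu : ∀ u ∈ sphere k m, (FreeGroup.mk u).toWord = u := fun u hu => by
    rw [FreeGroup.toWord_mk, (mem_sphere.1 hu).2.reduce_eq]
  by_cases hR : R < m + 1
  · refine le_trans ?_ (h hR)
    rw [Nat.cast_le]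
    refine Finset.card_le_card fun u h' => ?_
    rw [Finset.mem_filter] at h' ⊢
    have := (hB _ h'.2).2
    rw [hu u h'.1] at this
    exact ⟨h'.1, this⟩
  · rw [Finset.filter_false_of_mem, Finset.card_empty, Nat.cast_zero]
    · positivity
    · intro u hus hmem
      have h' := (hB _ hmem).1
      rw [wlen, hu u hus, (mem_sphere.1 hus).1] at h'
      push_cast at h'
      exact hR h'

lemma measure_pi_eval {p : ℕ} (μ : Fin p → Measure (FreeGroup (Fin k)))
    [∀ i, IsProbabilityMeasure (μ i)] (i : Fin p) (B : Set (FreeGroup (Fin k))) :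
    Measure.pi μ {w | w i ∈ B} = μ i B :=
  (measurePreserving_eval μ i).measure_preimage (measurableSet_freeGroup B).nullMeasurableSet

/-- Two independent elements, the first of which is radial, rarely share a long initial segment. -/
lemma measure_pi_common_prefix_le {p : ℕ} (hk : 2 ≤ k) (μ : Fin p → Measure (FreeGroup (Fin k)))
    [∀ i, IsProbabilityMeasure (μ i)] {i j : Fin p} (hij : i ≠ j) (hμ : IsRadial (μ i)) {R : ℝ}
    (hR : 0 ≤ R) {t : ℕ} (ht : 2 * t ≤ R) (e e' : Bool) :
    Measure.pi μ {w | R < wlen (w i) ∧ (cond e (w i) (w i)⁻¹).toWord.take t =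
      (cond e' (w j) (w j)⁻¹).toWord.take t} ≤ ENNReal.ofReal (Real.exp (-t)) := by
  set P : List (Fin k × Bool) → Set (FreeGroup (Fin k)) := fun v =>
    {g | cond e g g⁻¹ ∈ {g : FreeGroup (Fin k) | R < wlen g ∧ g.toWord.take t = v}} with hP
  set Q : List (Fin k × Bool) → Set (FreeGroup (Fin k)) := fun v =>
    {g | (cond e' g g⁻¹).toWord.take t = v} with hQ
  have hPle : ∀ v, μ i (P v) ≤ ENNReal.ofReal (Real.exp (-t)) := by
    intro v
    refine hμ.measure_cond_inv_le e _ (Real.exp_pos _).le (fun m => ?_) ?_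
    · refine card_filter_mk_mem_le (P := fun u => u.take t = v) (Real.exp_pos _).le m
        (fun g hg => hg) fun hm => ?_
      refine card_take_eq_le hk ?_ v
      have : (2 * t : ℝ) < m + 1 := by linarith
      have : 2 * t < m + 1 := by exact_mod_cast this
      omega
    · rintro ⟨h, -⟩
      simp [wlen] at h
      linarith
  have hcover : {w : Fin p → FreeGroup (Fin k) | R < wlen (w i) ∧
      (cond e (w i) (w i)⁻¹).toWord.take t = (cond e' (w j) (w j)⁻¹).toWord.take t} ⊆
      ⋃ v, {w | w i ∈ P v} ∩ {w | w j ∈ Q v} := by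
    rintro w ⟨h1, h2⟩
    refine Set.mem_iUnion.2 ⟨_, ⟨?_, h2⟩, rfl⟩
    cases e
    · simpa [wlen_inv] using h1
    · exact h1
  have hind : ∀ v, Measure.pi μ ({w | w i ∈ P v} ∩ {w | w j ∈ Q v}) = μ i (P v) * μ j (Q v) := by
    intro v
    have h := ProbabilityTheory.iIndepFun_pi (μ := μ) (X := fun _ g => g)
      fun _ => measurable_id.aemeasurable
    have := (h.indepFun hij).measure_inter_preimage_eq_mul (P v) (Q v)
      (measurableSet_freeGroup _) (measurableSet_freeGroup _)
    rw [← measure_pi_eval μ i, ← measure_pi_eval μ j]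
    exact this
  calc _ ≤ ∑' v, Measure.pi μ ({w | w i ∈ P v} ∩ {w | w j ∈ Q v}) :=
        (measure_mono hcover).trans (measure_iUnion_le _)
    _ ≤ ∑' v, ENNReal.ofReal (Real.exp (-t)) * μ j (Q v) := by
        refine ENNReal.tsum_le_tsum fun v => ?_
        rw [hind]
        gcongr
        exact hPle v
    _ = ENNReal.ofReal (Real.exp (-t)) * μ j (⋃ v, Q v) := by
        rw [ENNReal.tsum_mul_left, MeasureTheory.measure_iUnion _ fun _ => measurableSet_freeGroup _]
        intro u v huv
        rw [Function.onFun, Set.disjoint_left]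
        intro g hg hg'
        exact huv (hg.symm.trans hg')
    _ ≤ _ := mul_le_of_le_one_right' prob_le_one

/-- A radial element rarely shares a long prefix with its inverse. -/
lemma IsRadial.measure_common_prefix_inv_le (hk : 2 ≤ k) {μ : Measure (FreeGroup (Fin k))}
    [IsProbabilityMeasure μ] (hμ : IsRadial μ) {R : ℝ} (hR : 0 ≤ R) {t : ℕ} (ht : 2 * t ≤ R) :
    μ {g | R < wlen g ∧ g.toWord.take t = g⁻¹.toWord.take t} ≤
      ENNReal.ofReal (Real.exp (-t)) := by
  simp only [FreeGroup.toWord_inv]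
  refine hμ.measure_le _ (Real.exp_pos _).le (fun m => ?_) ?_
  · refine card_filter_mk_mem_le (P := fun u => u.take t = (FreeGroup.invRev u).take t)
      (Real.exp_pos _).le m (fun g hg => hg) fun hm => ?_
    refine card_take_eq_take_invRev_le hk ?_
    have : (2 * t : ℝ) < m + 1 := by linarith
    have : 2 * t < m + 1 := by exact_mod_cast this
    omega
  · rintro ⟨h, -⟩
    simp [wlen] at h
    linarith

/-- A radial element rarely has a small pair sum. -/
lemma IsRadial.measure_pairSum_lt_le (hk : 2 ≤ k) {μ : Measure (FreeGroup (Fin k))}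
    [IsProbabilityMeasure μ] (hμ : IsRadial μ) {R : ℝ} (hR : 0 ≤ R) (t : ℕ)
    {f : Fin k × Bool → Fin k × Bool → ℝ} {K c σ : ℝ} (hK : 1 ≤ K) (hf : ∀ x y, |f x y| ≤ K)
    (hc : 0 < c) (hfc : ∀ x, c ≤ ∑ y with y ≠ invL x, f x y)
    (hσ : σ = c ^ 2 / (4 * (2 * k - 1) ^ 2 * K ^ 2)) (e : Bool) :
    μ {g | R < wlen g ∧ pairSum f (cond e g g⁻¹).toWord < K * (2 * t + 3)} ≤
      ENNReal.ofReal (Real.exp (t + 2 - σ * (R - 1))) := by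
  have hσ0 : 0 ≤ σ := by rw [hσ]; positivity
  have h := hμ.measure_cond_inv_le e
    {g : FreeGroup (Fin k) | R < wlen g ∧ pairSum f g.toWord < K * (2 * t + 3)}
    (c := Real.exp (t + 2 - σ * (R - 1))) (Real.exp_pos _).le (fun m => ?_) ?_
  · refine le_trans (measure_mono ?_) h
    rintro g ⟨h1, h2⟩
    refine ⟨?_, h2⟩
    cases e
    · simpa [wlen_inv] using h1
    · exact h1
  · refine card_filter_mk_mem_le (P := fun u => pairSum f u < K * (2 * t + 3))
      (Real.exp_pos _).le m (fun g hg => hg) fun hm => ?_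
    refine (card_pairSum_lt_le hk hK hf hc hfc m t).trans ?_
    rw [← hσ]
    gcongr
    linarith
  · rintro ⟨h, -⟩
    simp [wlen] at h
    linarith

end Radial

section Minimality

variable {k : ℕ}

/-- Uniform bounds for the coboundaries correcting the weights of all non-inner Whitehead
automorphisms. -/
lemma exists_bound_coboundary_whiteheadWeight (hk : 2 ≤ k) :
    ∃ K B : ℝ, 1 ≤ K ∧ 0 ≤ B ∧ ∃ b : Set (Fin k × Bool) × (Fin k × Bool) → Fin k × Bool → ℝ,
      ∀ s, 2 ≤ s.1.ncard → s.1.ncard + 2 ≤ 2 * k → (∀ x, |b s x| ≤ B) ∧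
        (∀ x y, |whiteheadWeight s.1 s.2 x y - 1 / (2 * k * (2 * k - 1)) + b s y - b s x| ≤ K) ∧
        ∀ x, 1 / (2 * (k : ℝ)) ≤ ∑ y with y ≠ invL x,
          (whiteheadWeight s.1 s.2 x y - 1 / (2 * k * (2 * k - 1)) + b s y - b s x) := by
  have h : ∀ s : Set (Fin k × Bool) × (Fin k × Bool), ∃ b : Fin k × Bool → ℝ,
      2 ≤ s.1.ncard → s.1.ncard + 2 ≤ 2 * k → ∀ x, 1 / (2 * (k : ℝ)) ≤ ∑ y with y ≠ invL x,
        (whiteheadWeight s.1 s.2 x y - 1 / (2 * k * (2 * k - 1)) + b y - b x) := by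
    intro s
    by_cases h : 2 ≤ s.1.ncard ∧ s.1.ncard + 2 ≤ 2 * k
    · obtain ⟨b, hb⟩ := exists_coboundary_whiteheadWeight hk s.1 s.2 h.1 h.2
      exact ⟨b, fun _ _ => hb⟩
    · exact ⟨0, fun h1 h2 => absurd ⟨h1, h2⟩ h⟩
  choose b hb using h
  obtain ⟨B, hB⟩ := (Set.finite_range fun q : (Set (Fin k × Bool) × (Fin k × Bool)) ×
    (Fin k × Bool) => |b q.1 q.2|).bddAbove
  obtain ⟨K, hK⟩ := (Set.finite_range fun q : (Set (Fin k × Bool) × (Fin k × Bool)) ×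
    (Fin k × Bool) × (Fin k × Bool) =>
      |whiteheadWeight q.1.1 q.1.2 q.2.1 q.2.2 - 1 / (2 * k * (2 * k - 1)) + b q.1 q.2.2 -
        b q.1 q.2.1|).bddAbove
  refine ⟨max 1 K, max 0 B, le_max_left _ _, le_max_left _ _, b, fun s h1 h2 =>
    ⟨fun x => ?_, fun x y => ?_, hb s h1 h2⟩⟩
  · exact (hB ⟨(s, x), rfl⟩).trans (le_max_right _ _)
  · exact (hK ⟨(s, x, y), rfl⟩).trans (le_max_right _ _)

/-- An element along which the corrected weight is non-negative is stretched. -/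
lemma stretch_of_pairSum_nonneg {A : Set (Fin k × Bool)} {a : Fin k × Bool} (ha : a ∈ A)
    (ha' : invL a ∉ A) {b : Fin k × Bool → ℝ} {B η : ℝ} (hη : 0 ≤ η) (hB : 0 ≤ B)
    (hb : ∀ x, |b x| ≤ B) {h : FreeGroup (Fin k)}
    (hs : 0 ≤ pairSum (fun x y => whiteheadWeight A a x y - η + b y - b x) h.toWord) :
    (1 + η) * wlen h - (2 * B + 2 + η) ≤ wlen (whiteheadAut k A a h) := by
  have h1 := le_wlen_whiteheadAut ha ha' h
  have h2 := pairSum_coboundary_le (f := fun x y => whiteheadWeight A a x y - η) hb hB h.toWord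
  rcases hw : h.toWord with _ | ⟨x, l⟩
  · have : wlen h = 0 := by rw [wlen, hw, List.length_nil]
    rw [this]
    have := Nat.cast_nonneg (α := ℝ) (wlen (whiteheadAut k A a h))
    push_cast
    linarith
  · have hlen : (wlen h : ℝ) = l.length + 1 := by simp [wlen, hw]
    rw [hw] at h1 h2 hs
    rw [pairSum_sub_const] at h2
    nlinarith

/-- If the generators `w i` are long, with short common prefixes, and have large corrected pair
sums, then the elements of the subgroup they generate are strictly Whitehead minimal. -/
lemma wlen_rotate_lt_of_pairSum_le {p : ℕ} (w : Fin p → FreeGroup (Fin k))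
    {A : Set (Fin k × Bool)} {a : Fin k × Bool} (ha : a ∈ A) (ha' : invL a ∉ A)
    {b : Fin k × Bool → ℝ} {B K η : ℝ} (hη : 0 < η) (hB : 0 ≤ B) (hK : 0 ≤ K)
    (hb : ∀ x, |b x| ≤ B) (hf : ∀ x y, |whiteheadWeight A a x y - η + b y - b x| ≤ K) {t : ℕ}
    (hlen : ∀ i, 2 * t ≤ wlen (w i))
    (hdist : ∀ i j, i ≠ j → ∀ e e' : Bool, (cond e (w i) (w i)⁻¹).toWord.take t ≠
      (cond e' (w j) (w j)⁻¹).toWord.take t)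
    (hdist' : ∀ i, (w i).toWord.take t ≠ (w i)⁻¹.toWord.take t)
    (hsum : ∀ i e, K * (2 * t + 3) ≤
      pairSum (fun x y => whiteheadWeight A a x y - η + b y - b x)
        (cond e (w i) (w i)⁻¹).toWord)
    {g c r : FreeGroup (Fin k)} (hg : g ∈ Subgroup.closure (Set.range w)) (hg1 : g ≠ 1)
    (hr : IsCyclicallyReduced r) (hgr : g = c * r * c⁻¹) (m : ℕ) :
    wlen (FreeGroup.mk (r.toWord.rotate m)) <
      wlen (whiteheadAut k A a (FreeGroup.mk (r.toWord.rotate m))) := by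
  refine wlen_rotate_lt_of_stretch (C := 2 * B + 2 + η) (whiteheadAut k A a)
    (Subgroup.closure (Set.range w)) hη (fun h hh => ?_) hg hg1 hr hgr m
  rw [← FreeGroup.range_lift_eq_closure] at hh
  obtain ⟨y, rfl⟩ := hh
  refine stretch_of_pairSum_nonneg ha ha' hη.le hB hb ?_
  refine pairSum_lift_nonneg hf hK w t ?_ ?_ (fun x => hsum x.1 x.2) y
  · rintro ⟨i, e⟩
    cases e
    · exact (hlen i).trans_eq (wlen_inv (w i)).symm
    · exact hlen i
  · rintro ⟨i, e⟩ ⟨j, e'⟩ h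
    by_cases hij : i = j
    · subst hij
      cases e <;> cases e'
      · rfl
      · exact absurd h.symm (hdist' i)
      · exact absurd h (hdist' i)
      · rfl
    · exact absurd h (hdist i j hij e e')

end Minimality

/-- `μ n i` is the distribution of `w_{i,n}`; independence is expressed
by the product measure. Under radial symmetry, positive drift and subexponential growth,
with probability going to 1 exponentially fast: for every non-trivial `g` in
`H = ⟨w_{1,n}, …, w_{p,n}⟩`, every cyclic permutation `g'` of the cyclic reduction `r`
of `g` satisfies `|φ(g')| > |g'|` for every Whitehead automorphism `φ = φ_{(A,a)}`
which is not inner. -/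
theorem whitehead_minimality (k p : ℕ) (hk : 2 ≤ k) (hp : 1 ≤ p)
    (μ : ℕ → Fin p → Measure (FreeGroup (Fin k)))
    (hprob : ∀ n i, IsProbabilityMeasure (μ n i))
    (hradial : ∀ n i (g g' : FreeGroup (Fin k)), wlen g = wlen g' →
      μ n i {g} = μ n i {g'})
    (L : ℝ) (hL : 0 < L)
    (hdrift : ∀ i, ExpDecay (fun n => μ n i {g | ¬ (L * n < (wlen g : ℝ))}))
    (hsubexp : ∀ θ : ℝ, 0 < θ → ∀ i,
      ExpDecay (fun n => μ n i {g | ¬ ((wlen g : ℝ) ≤ Real.exp (θ * n))})) :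
    ExpDecay (fun n =>
      Measure.pi (μ n)
        {w : Fin p → FreeGroup (Fin k) |
          ¬ (∀ g : FreeGroup (Fin k), g ∈ Subgroup.closure (Set.range w) → g ≠ 1 →
            ∀ c r : FreeGroup (Fin k), IsCyclicallyReduced r → g = c * r * c⁻¹ →
            ∀ m : ℕ, ∀ (A : Set (Fin k × Bool)) (a : Fin k × Bool),
              a ∈ A → invL a ∉ A →
              (¬ ∃ z : FreeGroup (Fin k), ∀ y, whiteheadAut k A a y = z * y * z⁻¹) →
              wlen (FreeGroup.mk ((FreeGroup.toWord r).rotate m)) <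
                wlen (whiteheadAut k A a
                  (FreeGroup.mk ((FreeGroup.toWord r).rotate m))))}) := by
  have hkR : (2 : ℝ) ≤ k := by exact_mod_cast hk
  have hq : (0 : ℝ) < 2 * k - 1 := by linarith
  obtain ⟨K, B, hK, hB, b, hb⟩ := exists_bound_coboundary_whiteheadWeight hk
  obtain ⟨σ, hσ⟩ : ∃ σ : ℝ, σ = (1 / (2 * k)) ^ 2 / (4 * (2 * k - 1) ^ 2 * K ^ 2) := ⟨_, rfl⟩
  have hσ0 : 0 < σ := by rw [hσ]; positivity
  obtain ⟨ε, hε⟩ : ∃ ε : ℝ, ε = min (L / 2) (σ * L / 2) := ⟨_, rfl⟩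
  have hε0 : 0 < ε := by rw [hε]; exact lt_min (by positivity) (by positivity)
  have hεL : ε ≤ L / 2 := hε ▸ min_le_left _ _
  have hεσ : ε ≤ σ * L / 2 := hε ▸ min_le_right _ _
  set t : ℕ → ℕ := fun n => ⌊ε * n⌋₊
  have ht1 : ∀ n, (t n : ℝ) ≤ ε * n := fun n => Nat.floor_le (by positivity)
  have ht2 : ∀ n, ε * n - 1 ≤ t n := fun n => (Nat.sub_one_lt_floor _).le
  have htL : ∀ n, (2 * t n : ℝ) ≤ L * n := fun n => by
    have := mul_le_mul_of_nonneg_right hεL (Nat.cast_nonneg (α := ℝ) n)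
    linarith [ht1 n]
  have hR : ∀ n : ℕ, 0 ≤ L * n := fun n => by positivity
  set f : Set (Fin k × Bool) × (Fin k × Bool) → Fin k × Bool → Fin k × Bool → ℝ := fun s x y =>
    whiteheadWeight s.1 s.2 x y - 1 / (2 * k * (2 * k - 1)) + b s y - b s x
  have hexp : ∀ n, Real.exp (-t n) ≤ Real.exp (1 - ε * n) := fun n =>
    Real.exp_le_exp.2 (by linarith [ht2 n])
  have hshort : ∀ i, ExpDecay fun n => Measure.pi (μ n) {w | w i ∈ {g | ¬ L * n < wlen g}} :=
    fun i => (hdrift i).mono fun n => (measure_pi_eval (μ n) i _).le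
  have hsmall : ∀ q : Fin p × Bool × {s : Set (Fin k × Bool) × (Fin k × Bool) //
      2 ≤ s.1.ncard ∧ s.1.ncard + 2 ≤ 2 * k}, ExpDecay fun n => Measure.pi (μ n)
        {w | w q.1 ∈ {g | L * n < wlen g ∧
          pairSum (f q.2.2) (cond q.2.1 g g⁻¹).toWord < K * (2 * t n + 3)}} := by
    rintro ⟨i, e, s, h1, h2⟩
    obtain ⟨-, hb2, hb3⟩ := hb s h1 h2
    refine ExpDecay.of_le_exp (B := 2 + σ) (δ := σ * L / 2) (by positivity) fun n => ?_
    rw [measure_pi_eval]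
    refine (IsRadial.measure_pairSum_lt_le hk (hradial n i) (hR n) (t n) hK hb2 (by positivity)
      hb3 hσ e).trans (ENNReal.ofReal_le_ofReal (Real.exp_le_exp.2 ?_))
    have := mul_le_mul_of_nonneg_right hεσ (Nat.cast_nonneg (α := ℝ) n)
    linarith [ht1 n]
  have hcommon : ∀ q : {q : Fin p × Fin p // q.1 ≠ q.2} × Bool × Bool, ExpDecay fun n =>
      Measure.pi (μ n) {w | L * n < wlen (w q.1.1.1) ∧
        (cond q.2.1 (w q.1.1.1) (w q.1.1.1)⁻¹).toWord.take (t n) =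
          (cond q.2.2 (w q.1.1.2) (w q.1.1.2)⁻¹).toWord.take (t n)} := by
    rintro ⟨⟨⟨i, j⟩, hij⟩, e, e'⟩
    exact ExpDecay.of_le_exp (B := 1) hε0 fun n =>
      (measure_pi_common_prefix_le hk (μ n) hij (hradial n i) (hR n) (htL n) e e').trans
        (ENNReal.ofReal_le_ofReal (hexp n))
  have hcommon' : ∀ i, ExpDecay fun n => Measure.pi (μ n)
      {w | w i ∈ {g | L * n < wlen g ∧ g.toWord.take (t n) = g⁻¹.toWord.take (t n)}} := by
    intro i
    refine ExpDecay.of_le_exp (B := 1) hε0 fun n => ?_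
    rw [measure_pi_eval]
    exact (IsRadial.measure_common_prefix_inv_le hk (hradial n i) (hR n) (htL n)).trans
      (ENNReal.ofReal_le_ofReal (hexp n))
  refine (((ExpDecay.measure_iUnion hshort).measure_union
    (ExpDecay.measure_iUnion hsmall)).measure_union ((ExpDecay.measure_iUnion hcommon).measure_union
      (ExpDecay.measure_iUnion hcommon'))).mono fun n => measure_mono fun w hw => ?_
  by_contra hgood
  simp only [Set.mem_union, Set.mem_iUnion, Set.mem_ofPred_eq, not_or, not_exists, not_and,
    not_lt] at hgood
  obtain ⟨⟨hlong, hlarge⟩, hdist, hdist'⟩ := hgood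
  replace hlong := fun i => not_le.1 (hlong i)
  refine hw fun g hg hg1 c r hr hgr m A a ha ha' hA => ?_
  obtain ⟨h1, h2⟩ := ncard_bounds_of_not_inner ha ha' hA
  obtain ⟨hb1, hb2, -⟩ := hb (A, a) h1 h2
  refine wlen_rotate_lt_of_pairSum_le w ha ha' (t := t n) (by positivity) hB (by positivity) hb1 hb2
    (fun i => ?_) (fun i j hij e e' => hdist ⟨⟨(i, j), hij⟩, e, e'⟩ (hlong i))
    (fun i => hdist' i (hlong i)) (fun i e => hlarge ⟨i, e, (A, a), h1, h2⟩ (hlong i))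
    hg hg1 hr hgr m
  exact_mod_cast (htL n).trans (hlong i).le

end
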